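/- Fix p ∈ (0,1), δ ∈ (0,1) with (1−δ)(1+p) > 1, β > 8, and set t = ⌈1/p⌉ + 1. Fix α > 0. For n ∈ ℕ define π_n = β·log((1−δ)np)/((1−δ)np). Then there exists N such that for all n ≥ N and all integers k with αn/log(n) ≤ k ≤ n: [ Σ_{s=0}^{k} C(k,s)·p^s·(1−p)^{k−s}·((1 + (1−2π_n)^s)/2)^t ]^{(1−δ)np} ≤ ( (1 + exp(−βk·log(n)/n))/2 )^{(1−δ)(1+p)n}. -/

import Mathlib

open Finset

open Filter Topology

/-- A reverse Bernoulli inequality: `(1 - u) ^ j ≤ 1 - j u / 2` as long as `j u ≤ 1`. -/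
lemma one_sub_pow_le_one_sub_half_mul {u : ℝ} (hu0 : 0 ≤ u) (hu1 : u ≤ 1) {j : ℕ}
    (hj : j * u ≤ 1) : (1 - u) ^ j ≤ 1 - j * u / 2 := by
  have hprod : (1 - u) ^ j * (1 + u) ^ j ≤ 1 := by
    rw [← mul_pow]
    exact pow_le_one₀ (mul_nonneg (by linarith) (by linarith)) (by nlinarith)
  have hbern : 1 + j * u ≤ (1 + u) ^ j := one_add_mul_le_pow (by linarith) j
  have hpow : 0 ≤ (1 - u) ^ j := pow_nonneg (by linarith) j
  have hju : 0 ≤ j * u := by positivity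
  have hle : (1 - u) ^ j * (1 + j * u) ≤ 1 :=
    (mul_le_mul_of_nonneg_left hbern hpow).trans hprod
  refine le_of_mul_le_mul_right (hle.trans ?_) (by linarith : 0 < 1 + j * u)
  nlinarith

/-- Expanding the `t`-th power and summing the binomial distribution in closed form. -/
lemma sum_binomial_mul_half_one_add_pow (p r : ℝ) (k t : ℕ) :
    ∑ s ∈ Finset.range (k + 1),
        (k.choose s : ℝ) * p ^ s * (1 - p) ^ (k - s) * ((1 + r ^ s) / 2) ^ t =
      (∑ j ∈ Finset.range (t + 1), (t.choose j : ℝ) * (1 - p + p * r ^ j) ^ k) / 2 ^ t := by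
  have hexpand (s : ℕ) : (1 + r ^ s) ^ t =
      ∑ j ∈ Finset.range (t + 1), (t.choose j : ℝ) * (r ^ j) ^ s := by
    rw [add_comm, add_pow]
    refine Finset.sum_congr rfl fun j _ => ?_
    rw [one_pow, mul_one, mul_comm, pow_right_comm]
  simp_rw [div_pow, hexpand, ← mul_div_assoc, ← Finset.sum_div, Finset.mul_sum]
  rw [Finset.sum_comm]
  congr 1
  refine Finset.sum_congr rfl fun j _ => ?_
  rw [add_comm (1 - p), add_pow, Finset.mul_sum]
  refine Finset.sum_congr rfl fun s _ => ?_
  rw [mul_pow]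
  ring

/-- The binomial average of `((1 + (1 - u) ^ s) / 2) ^ t` is at most
`((1 + exp (-k p u / 2)) / 2) ^ t` as long as `t u ≤ 1`. -/
lemma sum_binomial_mul_half_one_add_pow_le {p u : ℝ} (hp0 : 0 ≤ p) (hp1 : p ≤ 1)
    (hu0 : 0 ≤ u) (hu1 : u ≤ 1) (k : ℕ) {t : ℕ} (ht : t * u ≤ 1) :
    ∑ s ∈ Finset.range (k + 1),
        (k.choose s : ℝ) * p ^ s * (1 - p) ^ (k - s) * ((1 + (1 - u) ^ s) / 2) ^ t ≤
      ((1 + Real.exp (-(k * p * u / 2))) / 2) ^ t := by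
  rw [sum_binomial_mul_half_one_add_pow, div_pow, add_comm (1 : ℝ) (Real.exp _), add_pow]
  refine div_le_div_of_nonneg_right (Finset.sum_le_sum fun j hj => ?_) (by positivity)
  rw [one_pow, mul_one, mul_comm]
  refine mul_le_mul_of_nonneg_right ?_ (Nat.cast_nonneg _)
  have hjt : (j : ℝ) ≤ t := by
    exact_mod_cast Nat.lt_succ_iff.mp (Finset.mem_range.mp hj)
  have hju : (1 - u) ^ j ≤ 1 - j * u / 2 :=
    one_sub_pow_le_one_sub_half_mul hu0 hu1 ((mul_le_mul_of_nonneg_right hjt hu0).trans ht)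
  have hpow : 0 ≤ (1 - u) ^ j := pow_nonneg (by linarith) j
  calc (1 - p + p * (1 - u) ^ j) ^ k ≤ Real.exp (-(p * (j * u / 2))) ^ k := by
        refine pow_le_pow_left₀ (add_nonneg (by linarith) (mul_nonneg hp0 hpow)) ?_ k
        have hexp := Real.add_one_le_exp (-(p * (j * u / 2)))
        have := mul_le_mul_of_nonneg_left hju hp0
        linarith
    _ = Real.exp (-(k * p * u / 2)) ^ j := by
        rw [← Real.exp_nat_mul, ← Real.exp_nat_mul]
        ring_nf

/-- large-`k` kernel bound for Algorithm RLNC(β).  With `t = ⌈1/p⌉+1` and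
`π_n = β log((1−δ)np)/((1−δ)np)`, for all large `n` and all `αn/log n ≤ k ≤ n`, the kernel
probability raised to the power `(1−δ)np` is at most
`((1+exp(−βk·log n/n))/2)^{(1−δ)(1+p)n}`. -/
theorem stmt_15 (p δ β α : ℝ) (hp0 : 0 < p) (hp1 : p < 1) (hδ0 : 0 < δ) (hδ1 : δ < 1)
    (hδp : 1 < (1 - δ) * (1 + p)) (hβ : 8 < β) (hα0 : 0 < α) :
    ∃ N : ℕ, ∀ n : ℕ, N ≤ n → ∀ k : ℕ, α * n / Real.log n ≤ (k : ℝ) → k ≤ n →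
      (∑ s ∈ Finset.range (k + 1),
          (k.choose s : ℝ) * p ^ s * (1 - p) ^ (k - s) *
            ((1 + (1 - 2 * (β * Real.log ((1 - δ) * n * p) / ((1 - δ) * n * p))) ^ s) / 2) ^
              (⌈1 / p⌉₊ + 1)) ^ ((1 - δ) * n * p) ≤
        ((1 + Real.exp (-(β * k * Real.log n / n))) / 2) ^ ((1 - δ) * (1 + p) * n) := by
  set t : ℕ := ⌈1 / p⌉₊ + 1 with ht
  have hδ : 0 < 1 - δ := by linarith
  have hc : 0 < (1 - δ) * p := mul_pos hδ hp0
  have htend : Tendsto (fun n : ℕ => (1 - δ) * (n : ℝ) * p) atTop atTop := by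
    have := (tendsto_natCast_atTop_atTop (R := ℝ)).const_mul_atTop hc
    exact this.congr fun n => by ring
  have hlog : Tendsto (fun n : ℕ => Real.log ((1 - δ) * n * p) / ((1 - δ) * n * p))
      atTop (𝓝 0) := by
    have := Real.isLittleO_log_id_atTop.tendsto_div_nhds_zero
    exact this.comp htend
  have hsmall : ∀ᶠ n : ℕ in atTop,
      t * (2 * β) * (Real.log ((1 - δ) * n * p) / ((1 - δ) * n * p)) < 1 := by
    have := hlog.const_mul (t * (2 * β))
    rw [mul_zero] at this
    exact this.eventually_lt_const one_pos
  have hlogn : ∀ᶠ n : ℕ in atTop, -Real.log ((1 - δ) * p) ≤ δ * Real.log n :=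
    ((Real.tendsto_log_atTop.comp tendsto_natCast_atTop_atTop).const_mul_atTop
      hδ0).eventually_ge_atTop _
  obtain ⟨N, hN⟩ := eventually_atTop.mp
    (((hsmall.and hlogn).and (htend.eventually_ge_atTop 1)).and (eventually_ge_atTop 1))
  refine ⟨N, fun n hn k _ _ => ?_⟩
  obtain ⟨⟨⟨htu, hlog_le⟩, hm1⟩, hn1⟩ := hN n hn
  have hn0 : (0 : ℝ) < n := by exact_mod_cast hn1
  have hlogm : (1 - δ) * Real.log n ≤ Real.log ((1 - δ) * n * p) := by
    rw [show (1 - δ) * n * p = (1 - δ) * p * n by ring, Real.log_mul hc.ne' hn0.ne']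
    linarith
  set m : ℝ := (1 - δ) * n * p with hm
  have hm0 : 0 < m := by linarith
  have hu0 : 0 ≤ 2 * (β * Real.log m / m) := by
    have := Real.log_nonneg hm1
    positivity
  have htu' : t * (2 * (β * Real.log m / m)) ≤ 1 := by
    rw [mul_div_assoc, ← mul_assoc 2, ← mul_assoc]
    exact htu.le
  have ht1 : (1 : ℝ) ≤ t := by rw [ht]; push_cast; linarith [Nat.cast_nonneg (α := ℝ) ⌈1 / p⌉₊]
  have hu1 : 2 * (β * Real.log m / m) ≤ 1 := by nlinarith
  have hexp : Real.exp (-(k * p * (2 * (β * Real.log m / m)) / 2)) ≤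
      Real.exp (-(β * k * Real.log n / n)) := by
    rw [Real.exp_le_exp, neg_le_neg_iff]
    have hrw : k * p * (2 * (β * Real.log m / m)) / 2 =
        β * k * (Real.log m / (1 - δ)) / n := by
      rw [hm]
      field_simp
    rw [hrw]
    have : Real.log n ≤ Real.log m / (1 - δ) := by
      rw [le_div_iff₀ hδ]
      linarith
    gcongr
  set A : ℝ := (1 + Real.exp (-(β * k * Real.log n / n))) / 2 with hA
  have hA0 : 0 < A := by positivity
  have hA1 : A ≤ 1 := by
    have : Real.exp (-(β * k * Real.log n / n)) ≤ 1 := by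
      rw [Real.exp_le_one_iff, neg_nonpos]
      have := Real.log_natCast_nonneg n
      positivity
    rw [hA]
    linarith
  have hsum := sum_binomial_mul_half_one_add_pow_le hp0.le hp1.le hu0 hu1 k htu'
  have hsumA := hsum.trans (pow_le_pow_left₀ (by positivity)
    (show _ ≤ A by rw [hA]; gcongr) t)
  have hsum0 : 0 ≤ ∑ s ∈ Finset.range (k + 1),
      (k.choose s : ℝ) * p ^ s * (1 - p) ^ (k - s) *
        ((1 + (1 - 2 * (β * Real.log m / m)) ^ s) / 2) ^ t := by
    have : 0 ≤ 1 - 2 * (β * Real.log m / m) := by linarith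
    have : 0 ≤ 1 - p := by linarith
    positivity
  refine (Real.rpow_le_rpow hsum0 hsumA hm0.le).trans ?_
  rw [← Real.rpow_natCast A t, ← Real.rpow_mul hA0.le]
  refine Real.rpow_le_rpow_of_exponent_ge hA0 hA1 ?_
  have htp : 1 / p + 1 ≤ t := by
    rw [ht]
    push_cast
    linarith [Nat.le_ceil (1 / p)]
  calc (1 - δ) * (1 + p) * n = (1 / p + 1) * m := by
        rw [hm]
        field_simp
    _ ≤ t * m := by gcongr
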